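/- arXiv:2112.04922 — 7 statements merged into one kernel-verified Lean document; each statement's English description precedes it below -/
import Mathlib

section
/- Let F : ℝ^d → ℝ be differentiable with ∇F L-Lipschitz, and let x : ℝ → ℝ^d have a continuous third derivative and satisfy x''(t) + (3/t)·x'(t) + ∇F(x(t)) = 0 for all t > 0. Fix t > 0. Then the truncation error L[x(t);h] := x(t+h) − ((2t−3h)/t)·x(t) + ((t−3h)/t)·x(t−h) + h²·∇F(x(t) + ((t−3h)/t)·(x(t)−x(t−h))) satisfies L[x(t);h] = O(h³) as h → 0; i.e., there exist M₀ > 0 and δ > 0 such that ‖L[x(t);h]‖ ≤ M₀·h³ for all 0 < h < δ. -/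
open Asymptotics Filter Topology in
/-- Second-order Taylor expansion of a `C³` curve, with a cubic remainder. -/
theorem ContDiff.sub_taylor_two_isBigO {E : Type*} [NormedAddCommGroup E] [NormedSpace ℝ E]
    {x : ℝ → E} (hx : ContDiff ℝ 3 x) (t : ℝ) :
    (fun h : ℝ => x (t + h) - x t - h • deriv x t - (h ^ 2 / 2) • deriv (deriv x) t)
      =O[𝓝 0] fun h => h ^ 3 := by
  have hT := (taylor_isLittleO_univ (x₀ := t) (n := 3) (by exact_mod_cast hx)).isBigO
  have hshift : Tendsto (fun h : ℝ => t + h) (𝓝 0) (𝓝 t) := by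
    simpa using (continuous_const_add t).tendsto 0
  have hT' := hT.comp_tendsto hshift
  have hcubic : (fun h : ℝ => h ^ 3 • ((1 / 6 : ℝ) • iteratedDeriv 3 x t))
      =O[𝓝 0] fun h => h ^ 3 := by
    simpa using (isBigO_refl (fun h : ℝ => h ^ 3) (𝓝 0)).smul
      (isBigO_const_const ((1 / 6 : ℝ) • iteratedDeriv 3 x t) (one_ne_zero (α := ℝ)) (𝓝 0))
  have hsum := IsBigO.add (g := fun h : ℝ => h ^ 3) (by simpa [Function.comp_def] using hT') hcubic
  refine hsum.congr_left fun h => ?_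
  have h2 : iteratedDeriv 2 x t = deriv (deriv x) t := by
    simp [iteratedDeriv_succ]
  rw [h2]
  norm_num [Nat.factorial]
  module

open Asymptotics Filter Topology in
/-- **Truncation error of the NAG scheme is `O(h³)`.**
If `∇F` is `L`-Lipschitz, `x` has a continuous third derivative and solves
`x''(t) + (3/t)x'(t) + ∇F(x(t)) = 0` for `t > 0`, then for fixed `t > 0` the truncation
error `L[x(t);h]` is `O(h³)` as `h → 0`. -/
theorem truncation_error_O_h3 {d : ℕ}
    (F : EuclideanSpace ℝ (Fin d) → ℝ)
    (gradF : EuclideanSpace ℝ (Fin d) → EuclideanSpace ℝ (Fin d))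
    (hgrad : ∀ u, HasGradientAt F (gradF u) u)
    (L : NNReal) (hLip : LipschitzWith L gradF)
    (x : ℝ → EuclideanSpace ℝ (Fin d))
    (hx : ContDiff ℝ 3 x)
    (hode : ∀ t > (0:ℝ),
      deriv (deriv x) t + (3 / t) • deriv x t + gradF (x t) = 0)
    (t : ℝ) (ht : 0 < t) :
    ∃ M₀ > (0:ℝ), ∃ δ > (0:ℝ), ∀ h : ℝ, 0 < h → h < δ →
      ‖x (t + h) - ((2 * t - 3 * h) / t) • x t + ((t - 3 * h) / t) • x (t - h)
          + h ^ 2 • gradF (x t + ((t - 3 * h) / t) • (x t - x (t - h)))‖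
        ≤ M₀ * h ^ 3 := by
  have ht' : t ≠ 0 := ht.ne'
  have hR := hx.sub_taylor_two_isBigO t
  have hneg : Tendsto (fun h : ℝ => -h) (𝓝 0) (𝓝 0) := by
    simpa using (continuous_neg (G := ℝ)).tendsto 0
  have hRneg : (fun h : ℝ => x (t - h) - x t + h • deriv x t - (h ^ 2 / 2) • deriv (deriv x) t)
      =O[𝓝 0] fun h => h ^ 3 := by
    have h3 := hR.comp_tendsto hneg
    have hcube : ((fun h : ℝ => h ^ 3) ∘ fun h => -h) = fun h : ℝ => -h ^ 3 := by
      ext h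
      simp [Odd.neg_pow (by decide : Odd 3)]
    rw [hcube] at h3
    refine h3.of_neg_right.congr_left fun h => ?_
    simp [sub_eq_add_neg]
  have hcoef : (fun h : ℝ => (t - 3 * h) / t) =O[𝓝 0] fun _ => (1 : ℝ) :=
    (Continuous.tendsto (by fun_prop) 0).isBigO_one ℝ
  have hcoefR := hcoef.smul hRneg
  have hacc : (fun h : ℝ => h ^ 3 • ((3 / (2 * t)) • deriv (deriv x) t))
      =O[𝓝 0] fun h => h ^ 3 := by
    simpa using (isBigO_refl (fun h : ℝ => h ^ 3) (𝓝 0)).smul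
      (isBigO_const_const ((3 / (2 * t)) • deriv (deriv x) t) (one_ne_zero (α := ℝ)) (𝓝 0))
  have hstep : (fun h : ℝ => x t - x (t - h)) =O[𝓝 0] fun h => h := by
    have hd := (hx.differentiable (by norm_num) t).isBigO_sub
    have hshift : Tendsto (fun h : ℝ => t - h) (𝓝 0) (𝓝 t) :=
      Continuous.tendsto' (by fun_prop) 0 t (by simp)
    have h1 := hd.comp_tendsto hshift
    have hid : ((fun s : ℝ => s - t) ∘ fun h => t - h) = fun h : ℝ => -h := by
      ext h
      simp
    rw [hid] at h1
    refine h1.of_neg_right.neg_left.congr_left fun h => ?_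
    simp
  have hgradDiff : (fun h : ℝ => gradF (x t + ((t - 3 * h) / t) • (x t - x (t - h))) - gradF (x t))
      =O[𝓝 0] fun h => h := by
    have hdisp := hcoef.smul hstep
    simp only [one_smul] at hdisp
    refine (IsBigO.of_bound L (Eventually.of_forall fun h => ?_)).trans hdisp
    simpa using hLip.norm_sub_le (x t + ((t - 3 * h) / t) • (x t - x (t - h))) (x t)
  have hforce := (isBigO_refl (fun h : ℝ => h ^ 2) (𝓝 0)).smul hgradDiff
  simp only [smul_eq_mul, one_mul, ← pow_succ, Nat.reduceAdd] at hcoefR hforce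
  have htotal := ((hR.add hcoefR).sub hacc).add hforce
  obtain ⟨M, hM, hbound⟩ := htotal.exists_pos
  obtain ⟨δ, hδ, hball⟩ := Metric.eventually_nhds_iff.mp hbound.bound
  refine ⟨M, hM, δ, hδ, fun h h0 hlt => ?_⟩
  have key := hball (y := h) (by simpa [abs_of_pos h0] using hlt)
  rw [Real.norm_of_nonneg (by positivity)] at key
  refine le_of_eq_of_le (congrArg norm ?_) key
  have hg : gradF (x t) = -(deriv (deriv x) t) - (3 / t) • deriv x t := by
    rw [← sub_eq_zero, ← hode t ht]
    abel
  rw [hg]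
  match_scalars <;> field_simp <;> ring
end

section
/- Let F : ℝ^d → ℝ be differentiable with ∇F L-Lipschitz, and let x : ℝ → ℝ^d have a continuous third derivative and satisfy x''(t) + (3/t)·x'(t) + ∇F(x(t)) = 0 for t > 0. Fix t₀ > 0. Then there exist constants M₁, M₂ > 0 (depending on t₀) such that for every h > 0 and every integer n ≥ 1 with n·h < t₀, the truncation error at tₙ = n·h satisfies ‖L[x(tₙ);h]‖ ≤ M₁·h³ + M₂·h²/n. -/
/-- Second-order Taylor estimate, with a crude constant, valid on either side of the base point. -/
theorem norm_sub_taylor_two_le {E : Type*} [NormedAddCommGroup E] [NormedSpace ℝ E]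
    {f f₁ f₂ f₃ : ℝ → E} {C t s : ℝ}
    (h₁ : ∀ r, HasDerivAt f (f₁ r) r) (h₂ : ∀ r, HasDerivAt f₁ (f₂ r) r)
    (h₃ : ∀ r, HasDerivAt f₂ (f₃ r) r) (hC : ∀ r ∈ Set.uIcc t s, ‖f₃ r‖ ≤ C) :
    ‖f s - f t - (s - t) • f₁ t - ((s - t) ^ 2 / 2) • f₂ t‖ ≤ C * |s - t| ^ 3 := by
  have hC0 : 0 ≤ C := (norm_nonneg _).trans (hC t Set.left_mem_uIcc)
  have hdist : ∀ r ∈ Set.uIcc t s, |r - t| ≤ |s - t| := fun r hr =>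
    Set.abs_sub_left_of_mem_uIcc hr
  have mvt : ∀ (g g' : ℝ → E) (K : ℝ), (∀ r, HasDerivAt g (g' r) r) →
      (∀ r ∈ Set.uIcc t s, ‖g' r‖ ≤ K) → ∀ r ∈ Set.uIcc t s, ‖g r - g t‖ ≤ K * |r - t| :=
    fun g g' K hg hK r hr => (convex_uIcc t s).norm_image_sub_le_of_norm_hasDerivWithin_le
      (fun y _ => (hg y).hasDerivWithinAt) hK Set.left_mem_uIcc hr
  have e₂ : ∀ r ∈ Set.uIcc t s, ‖f₂ r - f₂ t‖ ≤ C * |s - t| := fun r hr =>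
    (mvt f₂ f₃ C h₃ hC r hr).trans (mul_le_mul_of_nonneg_left (hdist r hr) hC0)
  have e₁ : ∀ r ∈ Set.uIcc t s, ‖f₁ r - f₁ t - (r - t) • f₂ t‖ ≤ C * |s - t| * |s - t| := by
    intro r hr
    have hd : ∀ y, HasDerivAt (fun y => f₁ y - (y - t) • f₂ t) (f₂ y - f₂ t) y := fun y => by
      simpa using (h₂ y).fun_sub (((hasDerivAt_id y).sub_const t).smul_const (f₂ t))
    have := mvt _ _ _ hd e₂ r hr
    have h' := this.trans (mul_le_mul_of_nonneg_left (hdist r hr) (by positivity))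
    refine le_of_eq_of_le (congrArg norm ?_) h'
    module
  have hd : ∀ y, HasDerivAt (fun y => f y - (y - t) • f₁ t - ((y - t) ^ 2 / 2) • f₂ t)
      (f₁ y - f₁ t - (y - t) • f₂ t) y := fun y => by
    have hy := (hasDerivAt_id y).sub_const t
    simpa using ((h₁ y).fun_sub (hy.smul_const (f₁ t))).fun_sub
      (((hy.fun_pow 2).div_const 2).smul_const (f₂ t))
  have := mvt _ _ _ hd e₁ s Set.right_mem_uIcc
  calc _ = ‖(f s - (s - t) • f₁ t - ((s - t) ^ 2 / 2) • f₂ t) -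
          (f t - (t - t) • f₁ t - ((t - t) ^ 2 / 2) • f₂ t)‖ := by
        refine congrArg norm ?_
        module
    _ ≤ _ := this
    _ = _ := by ring


/-- **Truncation error bound at `tₙ = n·h`.**
For fixed `t₀ > 0`, there exist `M₁, M₂ > 0` such that for every `h > 0` and every
integer `n ≥ 1` with `n·h < t₀`, the truncation error at `tₙ = n·h` satisfies
`‖L[x(tₙ);h]‖ ≤ M₁h³ + M₂h²/n`. -/
theorem truncation_error_at_tn {d : ℕ}
    (F : EuclideanSpace ℝ (Fin d) → ℝ)
    (gradF : EuclideanSpace ℝ (Fin d) → EuclideanSpace ℝ (Fin d))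
    (hgrad : ∀ u, HasGradientAt F (gradF u) u)
    (L : NNReal) (hLip : LipschitzWith L gradF)
    (x : ℝ → EuclideanSpace ℝ (Fin d))
    (hx : ContDiff ℝ 3 x)
    (hode : ∀ t > (0:ℝ),
      deriv (deriv x) t + (3 / t) • deriv x t + gradF (x t) = 0)
    (t₀ : ℝ) (ht₀ : 0 < t₀) :
    ∃ M₁ > (0:ℝ), ∃ M₂ > (0:ℝ), ∀ h : ℝ, 0 < h → ∀ n : ℕ, 1 ≤ n → (n : ℝ) * h < t₀ →
      ‖x ((n : ℝ) * h + h) - ((2 * ((n : ℝ) * h) - 3 * h) / ((n : ℝ) * h)) • x ((n : ℝ) * h)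
          + (((n : ℝ) * h - 3 * h) / ((n : ℝ) * h)) • x ((n : ℝ) * h - h)
          + h ^ 2 • gradF (x ((n : ℝ) * h)
              + (((n : ℝ) * h - 3 * h) / ((n : ℝ) * h)) • (x ((n : ℝ) * h) - x ((n : ℝ) * h - h)))‖
        ≤ M₁ * h ^ 3 + M₂ * h ^ 2 / n := by
  obtain ⟨hd₁, hx₁⟩ : Differentiable ℝ x ∧ ContDiff ℝ 2 (deriv x) := by
    have := (contDiff_succ_iff_deriv (n := 2)).1 (by simpa [two_add_one_eq_three] using hx)
    exact ⟨this.1, this.2.2⟩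
  obtain ⟨hd₂, hx₂⟩ : Differentiable ℝ (deriv x) ∧ ContDiff ℝ 1 (deriv (deriv x)) := by
    have := (contDiff_succ_iff_deriv (n := 1)).1 (by simpa [one_add_one_eq_two] using hx₁)
    exact ⟨this.1, this.2.2⟩
  have hd₃ : Differentiable ℝ (deriv (deriv x)) := hx₂.differentiable (by simp)
  have bound : ∀ g : ℝ → EuclideanSpace ℝ (Fin d), Continuous g →
      ∃ C > 0, ∀ r ∈ Set.Icc 0 (2 * t₀), ‖g r‖ ≤ C := fun g hg => by
    obtain ⟨C, hC⟩ := (isCompact_Icc (a := 0) (b := 2 * t₀)).exists_bound_of_continuousOn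
      hg.continuousOn
    exact ⟨max C 1, by positivity, fun r hr => (hC r hr).trans (le_max_left _ _)⟩
  obtain ⟨C₁, hC₁, b₁⟩ := bound _ hx₁.continuous
  obtain ⟨C₂, hC₂, b₂⟩ := bound _ hx₂.continuous
  obtain ⟨C₃, hC₃, b₃⟩ := bound _ (hx₂.continuous_deriv le_rfl)
  refine ⟨3 * C₃ + 2 * L * C₁, by positivity, 3 / 2 * C₂, by positivity, ?_⟩
  intro h hh n hn hnt
  have hn1 : (1 : ℝ) ≤ n := by exact_mod_cast hn
  have hn0 : (n : ℝ) ≠ 0 := by positivity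
  have ht : h ≤ n * h := by nlinarith
  have hc₁ : (2 * (n * h) - 3 * h) / (n * h) = 2 - 3 / n := by field_simp
  have hc₂ : (n * h - 3 * h) / (n * h) = 1 - 3 / n := by field_simp
  have hode' := hode (n * h) (by positivity)
  have hc₃ : 3 / (n * h) = 3 / n / h := by field_simp
  rw [hc₁, hc₂]
  rw [hc₃] at hode'
  have hq : 3 / (n : ℝ) ≤ 3 := div_le_self (by norm_num) hn1
  have hq0 : 0 < 3 / (n : ℝ) := by positivity
  rw [show 3 / 2 * C₂ * h ^ 2 / n = 3 / n / 2 * h ^ 2 * C₂ by ring]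
  clear hc₁ hc₂ hc₃
  generalize 3 / (n : ℝ) = q at *
  generalize (n : ℝ) * h = t at *
  have hsub₁ : Set.uIcc t (t + h) ⊆ Set.Icc 0 (2 * t₀) :=
    Set.uIcc_subset_Icc ⟨by linarith, by linarith⟩ ⟨by linarith, by linarith⟩
  have hsub₂ : Set.uIcc t (t - h) ⊆ Set.Icc 0 (2 * t₀) :=
    Set.uIcc_subset_Icc ⟨by linarith, by linarith⟩ ⟨by linarith, by linarith⟩
  have T₁ := norm_sub_taylor_two_le (fun r => (hd₁ r).hasDerivAt) (fun r => (hd₂ r).hasDerivAt)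
    (fun r => (hd₃ r).hasDerivAt) (fun r hr => b₃ r (hsub₁ hr))
  have T₂ := norm_sub_taylor_two_le (fun r => (hd₁ r).hasDerivAt) (fun r => (hd₂ r).hasDerivAt)
    (fun r => (hd₃ r).hasDerivAt) (fun r hr => b₃ r (hsub₂ hr))
  have hdiff : ‖x t - x (t - h)‖ ≤ C₁ * h := by
    have := (convex_uIcc t (t - h)).norm_image_sub_le_of_norm_deriv_le (fun y _ => hd₁ y)
      (fun r hr => b₁ r (hsub₂ hr)) Set.right_mem_uIcc Set.left_mem_uIcc
    simpa [abs_of_pos hh] using this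
  have hq2 : |1 - q| ≤ 2 := abs_le.2 ⟨by linarith, by linarith⟩
  have hΔ : ‖gradF (x t + (1 - q) • (x t - x (t - h))) - gradF (x t)‖ ≤ L * (2 * (C₁ * h)) := by
    refine (hLip.norm_sub_le _ _).trans ?_
    rw [add_sub_cancel_left, norm_smul, Real.norm_eq_abs]
    gcongr
  have hb₂ := b₂ t ⟨by linarith, by linarith⟩
  rw [add_sub_cancel_left, abs_of_pos hh] at T₁
  rw [sub_sub_cancel_left, abs_neg, abs_of_pos hh] at T₂
  set R₁ := x (t + h) - x t - h • deriv x t - (h ^ 2 / 2) • deriv (deriv x) t with hR₁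
  set R₂ := x (t - h) - x t - (-h) • deriv x t - ((-h) ^ 2 / 2) • deriv (deriv x) t with hR₂
  set Δ := gradF (x t + (1 - q) • (x t - x (t - h))) - gradF (x t) with hΔdef
  have key : x (t + h) - (2 - q) • x t + (1 - q) • x (t - h)
      + h ^ 2 • gradF (x t + (1 - q) • (x t - x (t - h)))
      = R₁ + (1 - q) • R₂ + h ^ 2 • Δ - (q / 2 * h ^ 2) • deriv (deriv x) t := by
    have hode'' : h ^ 2 • deriv (deriv x) t + (h * q) • deriv x t + h ^ 2 • gradF (x t) = 0 := by
      have := congrArg (fun v => h ^ 2 • v) hode'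
      simp only [smul_add, smul_smul, smul_zero] at this
      rwa [show h ^ 2 * (q / h) = h * q by field_simp] at this
    rw [← sub_eq_zero, ← hode'', hR₁, hR₂, hΔdef]
    module
  rw [key]
  calc _ ≤ ‖R₁‖ + ‖(1 - q) • R₂‖ + ‖h ^ 2 • Δ‖ + ‖(q / 2 * h ^ 2) • deriv (deriv x) t‖ :=
        (norm_sub_le _ _).trans (by gcongr; exact norm_add₃_le)
    _ ≤ C₃ * h ^ 3 + 2 * (C₃ * h ^ 3) + h ^ 2 * (L * (2 * (C₁ * h))) + q / 2 * h ^ 2 * C₂ := by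
        simp only [norm_smul, Real.norm_eq_abs]
        rw [abs_of_pos (show 0 < h ^ 2 by positivity),
          abs_of_pos (show 0 < q / 2 * h ^ 2 by positivity)]
        gcongr
    _ = _ := by ring
end

section
/- Define for each integer n ≥ 0 the 2×2 real matrix Cₙ = [[(2n−1)/(n+1), −(n−2)/(n+1)], [1, 0]], and for 0 < l ≤ n+1 set D_{n,l} = Cₙ·C_{n−1}···C_{n−l+1}. Let P = [[1,1],[1,0]]. Then for every n ≥ 2 and every l with 0 < l ≤ n−2, there exist real numbers a_{n,l} and b_{n,l} with 0 < a_{n,l} ≤ l and 0 < b_{n,l} ≤ 1 such that D_{n,l} = P · [[1, a_{n,l}], [0, b_{n,l}]] · P⁻¹. -/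
/-- The matrix `Cₙ = [[(2n−1)/(n+1), −(n−2)/(n+1)], [1, 0]]`. -/
noncomputable def NAGMatC (n : ℕ) : Matrix (Fin 2) (Fin 2) ℝ :=
  !![(2 * (n : ℝ) - 1) / ((n : ℝ) + 1), -(((n : ℝ) - 2) / ((n : ℝ) + 1)); 1, 0]

/-- `D_{n,l} = Cₙ·C_{n−1}···C_{n−l+1}`, with `D_{n,0} = I₂`. -/
noncomputable def NAGMatD (n : ℕ) : ℕ → Matrix (Fin 2) (Fin 2) ℝ
  | 0 => 1
  | l + 1 => NAGMatD n l * NAGMatC (n - l)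

/-- The change of basis `!![1, 1; 1, 0]` makes every `Cₙ` upper triangular. -/
theorem NAGMatC_eq_conj (n : ℕ) :
    NAGMatC n = !![(1:ℝ), 1; 1, 0] * !![(1:ℝ), 1; 0, ((n : ℝ) - 2) / ((n : ℝ) + 1)] *
      (!![(1:ℝ), 1; 1, 0])⁻¹ := by
  have hn : (n : ℝ) + 1 ≠ 0 := by positivity
  have hP : IsUnit (!![(1:ℝ), 1; 1, 0]).det := by simp
  have key : NAGMatC n * !![(1:ℝ), 1; 1, 0] =
      !![(1:ℝ), 1; 1, 0] * !![(1:ℝ), 1; 0, ((n : ℝ) - 2) / ((n : ℝ) + 1)] := by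
    ext i j
    fin_cases i <;> fin_cases j <;> simp [NAGMatC] <;> field_simp <;> ring
  rw [← key, Matrix.mul_nonsing_inv_cancel_right _ _ hP]

theorem NAGMatD_succ_eq_conj {n l : ℕ} {a b : ℝ}
    (h : NAGMatD n l = !![(1:ℝ), 1; 1, 0] * !![(1:ℝ), a; 0, b] * (!![(1:ℝ), 1; 1, 0])⁻¹) :
    NAGMatD n (l + 1) = !![(1:ℝ), 1; 1, 0] *
      !![(1:ℝ), 1 + a * ((((n - l : ℕ) : ℝ) - 2) / (((n - l : ℕ) : ℝ) + 1));
        0, b * ((((n - l : ℕ) : ℝ) - 2) / (((n - l : ℕ) : ℝ) + 1))] *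
      (!![(1:ℝ), 1; 1, 0])⁻¹ := by
  have hP : IsUnit (!![(1:ℝ), 1; 1, 0]).det := by simp
  rw [NAGMatD, h, NAGMatC_eq_conj]
  simp only [Matrix.mul_assoc]
  rw [Matrix.nonsing_inv_mul_cancel_left _ _ hP, ← Matrix.mul_assoc !![(1:ℝ), a; 0, b],
    Matrix.mul_fin_two]
  simp

/-- **Triangular form of `D_{n,l}` with controlled entries.**
For `n ≥ 2` and `0 < l ≤ n−2`, `D_{n,l} = P·[[1,a],[0,b]]·P⁻¹` with `0 < a ≤ l`,
`0 < b ≤ 1`, where `P = [[1,1],[1,0]]`. -/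
theorem NAGMatD_triangular_form (n : ℕ) (hn : 2 ≤ n) (l : ℕ) (hl : 0 < l)
    (hln : l ≤ n - 2) :
    ∃ a b : ℝ, 0 < a ∧ a ≤ (l : ℝ) ∧ 0 < b ∧ b ≤ 1 ∧
      NAGMatD n l =
        !![(1:ℝ), 1; 1, 0] * !![(1:ℝ), a; 0, b] * (!![(1:ℝ), 1; 1, 0])⁻¹ := by
  induction l, hl using Nat.le_induction with
  | base =>
    have hq : (0 : ℝ) < ((n : ℝ) - 2) / ((n : ℝ) + 1) := by
      have : (3 : ℝ) ≤ n := by exact_mod_cast (by omega : 3 ≤ n)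
      exact div_pos (by linarith) (by linarith)
    refine ⟨1, _, one_pos, by simp, hq, ?_, ?_⟩
    · exact div_le_one_of_le₀ (by linarith) (by positivity)
    · simpa [NAGMatD] using NAGMatC_eq_conj n
  | succ l hl ih =>
    obtain ⟨a, b, ha, hal, hb, hb1, h⟩ := ih (by omega)
    have hm : (3 : ℝ) ≤ ((n - l : ℕ) : ℝ) := by exact_mod_cast (by omega : 3 ≤ n - l)
    have hq : 0 < (((n - l : ℕ) : ℝ) - 2) / (((n - l : ℕ) : ℝ) + 1) :=
      div_pos (by linarith) (by linarith)
    have hq1 : (((n - l : ℕ) : ℝ) - 2) / (((n - l : ℕ) : ℝ) + 1) ≤ 1 :=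
      div_le_one_of_le₀ (by linarith) (by linarith)
    refine ⟨_, _, by positivity, ?_, mul_pos hb hq, mul_le_one₀ hb1 hq.le hq1,
      NAGMatD_succ_eq_conj h⟩
    push_cast
    linarith [mul_le_of_le_one_right ha.le hq1]
end

section
/- Let F : ℝ^d → ℝ be differentiable with ∇F L-Lipschitz, and let x : ℝ → ℝ^d have a continuous third derivative and satisfy x''(t) + (3/t)·x'(t) + ∇F(x(t)) = 0 for t > 0. Fix t > 0. For each h > 0 with t/h an integer, define the sequence (xₙ) by x₀ = x(0), x₁ = x(h), and xₙ₊₁ = xₙ + ((n−3)/n)·(xₙ − xₙ₋₁) − h²·∇F(xₙ + ((n−3)/n)·(xₙ − xₙ₋₁)) for n ≥ 1. Then the overall error at time t satisfies ‖x(t) − x_{t/h}‖ = O(h·ln(1/h)) as h → 0; i.e., there exist C > 0 and δ > 0 such that ‖x(t) − x_{t/h}‖ ≤ C·h·ln(1/h) for all 0 < h < δ with t/h ∈ ℕ. In particular x_{t/h} → x(t) as h → 0. -/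
/-- Second-order Taylor bound on a convex set, from a bound on the third derivative. -/
theorem norm_sub_taylor_two_le_s7 {E : Type*} [NormedAddCommGroup E] [NormedSpace ℝ E]
    {x v a j : ℝ → E} {S : Set ℝ} (hS : Convex ℝ S) {B : ℝ}
    (hx : ∀ s, HasDerivAt x (v s) s) (hv : ∀ s, HasDerivAt v (a s) s)
    (ha : ∀ s, HasDerivAt a (j s) s) (hj : ∀ s ∈ S, ‖j s‖ ≤ B)
    {p q : ℝ} (hp : p ∈ S) (hq : q ∈ S) :
    ‖x q - x p - (q - p) • v p - ((q - p) ^ 2 / 2) • a p‖ ≤ B * |q - p| ^ 3 := by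
  have hB : 0 ≤ B := (norm_nonneg _).trans (hj p hp)
  have hsub : Set.uIcc p q ⊆ S := by
    rw [← segment_eq_uIcc]
    exact hS.segment_subset hp hq
  have hdist : ∀ s ∈ Set.uIcc p q, |s - p| ≤ |q - p| := fun s hs =>
    Set.abs_sub_left_of_mem_uIcc hs
  have hconv : Convex ℝ (Set.uIcc p q) := convex_uIcc p q
  have h1 : ∀ s ∈ Set.uIcc p q, ‖a s - a p‖ ≤ B * |q - p| := by
    intro s hs
    have := hconv.norm_image_sub_le_of_norm_hasDerivWithin_le (f := a) (f' := j) (C := B)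
      (fun r _ => (ha r).hasDerivWithinAt) (fun r hr => hj r (hsub hr)) Set.left_mem_uIcc hs
    refine this.trans ?_
    rw [Real.norm_eq_abs]
    exact mul_le_mul_of_nonneg_left (hdist s hs) hB
  have h2 : ∀ s ∈ Set.uIcc p q, ‖v s - v p - (s - p) • a p‖ ≤ B * |q - p| ^ 2 := by
    intro s hs
    have hd : ∀ r, HasDerivAt (fun r => v r - (r - p) • a p) (a r - a p) r := by
      intro r
      simpa using (hv r).fun_sub (((hasDerivAt_id r).sub_const p).smul_const (a p))
    have := hconv.norm_image_sub_le_of_norm_hasDerivWithin_le (C := B * |q - p|)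
      (fun r _ => (hd r).hasDerivWithinAt) h1 Set.left_mem_uIcc hs
    rw [Real.norm_eq_abs] at this
    calc ‖v s - v p - (s - p) • a p‖ = ‖v s - (s - p) • a p - (v p - (p - p) • a p)‖ := by
          congr 1; simp; abel
      _ ≤ B * |q - p| * |s - p| := this
      _ ≤ B * |q - p| * |q - p| := mul_le_mul_of_nonneg_left (hdist s hs) (by positivity)
      _ = _ := by ring
  have hd : ∀ r, HasDerivAt (fun r => x r - (r - p) • v p - ((r - p) ^ 2 / 2) • a p)
      (v r - v p - (r - p) • a p) r := by
    intro r
    have hid : HasDerivAt (fun r : ℝ => r - p) 1 r := (hasDerivAt_id r).sub_const p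
    have hsq : HasDerivAt (fun r : ℝ => (r - p) ^ 2 / 2) (r - p) r := by
      simpa using (hid.fun_pow 2).div_const 2
    simpa using ((hx r).fun_sub (hid.smul_const (v p))).fun_sub (hsq.smul_const (a p))
  have := hconv.norm_image_sub_le_of_norm_hasDerivWithin_le (C := B * |q - p| ^ 2)
    (fun r _ => (hd r).hasDerivWithinAt) h2 Set.left_mem_uIcc Set.right_mem_uIcc
  rw [Real.norm_eq_abs] at this
  calc _ = ‖x q - (q - p) • v p - ((q - p) ^ 2 / 2) • a p
        - (x p - (p - p) • v p - ((p - p) ^ 2 / 2) • a p)‖ := by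
        congr 1; simp; abel
    _ ≤ B * |q - p| ^ 2 * |q - p| := this
    _ = _ := by ring

/-- Truncation error of Nesterov's scheme along a solution of the limiting ODE. -/
theorem norm_nesterov_truncation_le {E : Type*} [NormedAddCommGroup E] [NormedSpace ℝ E]
    {x v a j : ℝ → E} {G : E → E} {L : NNReal} (hG : LipschitzWith L G)
    (hx : ∀ s, HasDerivAt x (v s) s) (hv : ∀ s, HasDerivAt v (a s) s)
    (ha : ∀ s, HasDerivAt a (j s) s)
    (hode : ∀ s > (0 : ℝ), a s + (3 / s) • v s + G (x s) = 0)
    {t B₁ B₂ B₃ : ℝ} (hB₁ : ∀ s ∈ Set.Icc 0 t, ‖v s‖ ≤ B₁)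
    (hB₂ : ∀ s ∈ Set.Icc 0 t, ‖a s‖ ≤ B₂) (hB₃ : ∀ s ∈ Set.Icc 0 t, ‖j s‖ ≤ B₃)
    {h n c : ℝ} (hh : 0 < h) (hn : 1 ≤ n) (hnt : (n + 1) * h ≤ t) (hc : c = (n - 3) / n) :
    ‖x ((n + 1) * h) - x (n * h) - c • (x (n * h) - x ((n - 1) * h))
      + h ^ 2 • G (x (n * h) + c • (x (n * h) - x ((n - 1) * h)))‖
      ≤ (3 / 2 * B₂ + 3 * B₃ * t + 2 * L * B₁ * t) * (h ^ 2 / n) := by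
  have hn0 : 0 < n := by linarith
  set p := n * h with hp
  have hp0 : 0 < p := by positivity
  have hpt : p ≤ t := by linarith [mul_comm n h]
  have hpS : p ∈ Set.Icc 0 t := ⟨hp0.le, hpt⟩
  have hqS : (n + 1) * h ∈ Set.Icc 0 t := ⟨by positivity, hnt⟩
  have hrS : (n - 1) * h ∈ Set.Icc 0 t :=
    ⟨mul_nonneg (by linarith) hh.le, by linarith⟩
  have hc2 : |c| ≤ 2 := by
    rw [hc, abs_le]
    constructor
    · rw [le_div_iff₀ hn0]; linarith
    · rw [div_le_iff₀ hn0]; linarith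
  have hq : (n + 1) * h - p = h := by rw [hp]; ring
  have hr : (n - 1) * h - p = -h := by rw [hp]; ring
  have hB₁0 : 0 ≤ B₁ := (norm_nonneg _).trans (hB₁ p hpS)
  have hB₂0 : 0 ≤ B₂ := (norm_nonneg _).trans (hB₂ p hpS)
  have hB₃0 : 0 ≤ B₃ := (norm_nonneg _).trans (hB₃ p hpS)
  have T₁ := norm_sub_taylor_two_le_s7 (convex_Icc 0 t) hx hv ha hB₃ hpS hqS
  have T₂ := norm_sub_taylor_two_le_s7 (convex_Icc 0 t) hx hv ha hB₃ hpS hrS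
  rw [hq, abs_of_pos hh] at T₁
  rw [hr, abs_neg, abs_of_pos hh] at T₂
  have T₀ : ‖x p - x ((n - 1) * h)‖ ≤ B₁ * h := by
    have := (convex_Icc 0 t).norm_image_sub_le_of_norm_hasDerivWithin_le
      (fun r _ => (hx r).hasDerivWithinAt) hB₁ hrS hpS
    rwa [← neg_sub ((n - 1) * h) p, hr, neg_neg, Real.norm_eq_abs, abs_of_pos hh] at this
  set R₁ := x ((n + 1) * h) - x p - h • v p - (h ^ 2 / 2) • a p with hR₁
  set R₂ := x ((n - 1) * h) - x p - (-h) • v p - ((-h) ^ 2 / 2) • a p with hR₂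
  set D := x p - x ((n - 1) * h) with hD
  have hGb : ‖G (x p + c • D) - G (x p)‖ ≤ L * (2 * (B₁ * h)) := by
    refine (hG.norm_sub_le _ _).trans ?_
    rw [add_sub_cancel_left, norm_smul, Real.norm_eq_abs]
    gcongr
  have key : x ((n + 1) * h) - x p - c • D + h ^ 2 • G (x p + c • D)
      = R₁ + c • R₂ - (3 / 2 * (h ^ 2 / n)) • a p
        + h ^ 2 • (G (x p + c • D) - G (x p)) := by
    have h0 : G (x p) = -(a p + (3 / p) • v p) := (neg_eq_of_add_eq_zero_right (hode p hp0)).symm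
    have hDR : D = -R₂ + h • v p - (h ^ 2 / 2) • a p := by rw [hR₂]; module
    have h1 : x ((n + 1) * h) - x p = R₁ + h • v p + (h ^ 2 / 2) • a p := by rw [hR₁]; module
    rw [h1, smul_sub (h ^ 2), h0]
    generalize G (x p + c • D) = g
    rw [hDR, hc, hp]
    match_scalars <;> field_simp <;> ring
  rw [key]
  have hh3 : h ^ 3 ≤ t * (h ^ 2 / n) := by
    rw [← mul_div_assoc, le_div_iff₀ hn0]
    nlinarith [mul_le_mul_of_nonneg_right hpt (sq_nonneg h)]
  calc _ ≤ ‖R₁‖ + ‖c • R₂‖ + ‖(3 / 2 * (h ^ 2 / n)) • a p‖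
        + ‖h ^ 2 • (G (x p + c • D) - G (x p))‖ :=
        (norm_add_le _ _).trans <| by
          gcongr
          exact (norm_sub_le _ _).trans (by gcongr; exact norm_add_le _ _)
    _ ≤ B₃ * h ^ 3 + 2 * (B₃ * h ^ 3) + 3 / 2 * (h ^ 2 / n) * B₂
        + h ^ 2 * (L * (2 * (B₁ * h))) := by
        simp only [norm_smul, Real.norm_eq_abs]
        rw [abs_of_nonneg (by positivity : 0 ≤ 3 / 2 * (h ^ 2 / n)),
          abs_of_nonneg (by positivity : 0 ≤ h ^ 2)]
        gcongr
        exact hB₂ p hpS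
    _ = 3 / 2 * B₂ * (h ^ 2 / n) + (3 * B₃ + 2 * L * B₁) * h ^ 3 := by ring
    _ ≤ 3 / 2 * B₂ * (h ^ 2 / n) + (3 * B₃ + 2 * L * B₁) * (t * (h ^ 2 / n)) := by gcongr
    _ = _ := by ring

/-- Discrete Grönwall estimate for the error recursion of Nesterov's scheme. -/
theorem norm_le_of_nesterov_recursion {E : Type*} [NormedAddCommGroup E] [NormedSpace ℝ E]
    {e : ℕ → E} {L C h : ℝ} {N : ℕ} (hL : 0 ≤ L) (hC : 0 ≤ C) (hh : 0 < h) (hh1 : h ≤ 1)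
    (he0 : e 0 = 0) (he1 : e 1 = 0)
    (hrec : ∀ m : ℕ, m + 1 < N → ∀ c : ℝ, c = (((m + 1 : ℕ) : ℝ) - 3) / ((m + 1 : ℕ) : ℝ) →
      ‖e (m + 2) - e (m + 1) - c • (e (m + 1) - e m)‖
        ≤ L * h ^ 2 * ‖e (m + 1) + c • (e (m + 1) - e m)‖ + C * (h ^ 2 / ((m + 1 : ℕ) : ℝ)))
    {n : ℕ} (hn : n ≤ N) :
    ‖e n‖ ≤ C / (4 * L + 1) * h * (1 + (4 * L + 1) * h) ^ n := by
  set K := 4 * L + 1 with hK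
  have hK1 : 1 ≤ K := by linarith
  have hK0 : 0 < K := by linarith
  set M := 1 + K * h with hM
  have hM1 : 1 ≤ M := by nlinarith
  have main : ∀ m : ℕ, m + 1 ≤ N → ‖e (m + 1) - e m‖ ≤ C * h ^ 2 * M ^ m ∧
      ‖e (m + 1)‖ ≤ C / K * h * M ^ (m + 1) := by
    intro m
    induction m with
    | zero =>
      intro _
      simp only [zero_add, he0, he1, sub_zero, norm_zero]
      exact ⟨by positivity, by positivity⟩
    | succ m ih =>
      intro hm
      obtain ⟨hw, hE⟩ := ih (by omega)
      have hr := hrec m (by omega) _ rfl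
      have step : ‖e (m + 2) - e (m + 1)‖ ≤ C * h ^ 2 * M ^ (m + 1) := by
        rcases Nat.eq_zero_or_pos m with rfl | hm0
        · simp only [zero_add, he0, he1, sub_zero, smul_zero, add_zero, norm_zero, mul_zero,
            Nat.cast_one, div_one, pow_one] at hr ⊢
          nlinarith [mul_nonneg hC (sq_nonneg h)]
        · set k : ℝ := ((m + 1 : ℕ) : ℝ) with hk
          have hk2 : 2 ≤ k := by rw [hk]; exact_mod_cast (by omega : 2 ≤ m + 1)
          have hk0 : 0 < k := by linarith
          set c := (k - 3) / k with hc
          have hcb : |c| ≤ 1 - 1 / k := by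
            have : 1 - 1 / k = (k - 1) / k := by field_simp
            rw [this, hc, abs_le, ← neg_div]
            constructor <;> gcongr <;> linarith
          have hk1 : 0 ≤ 1 - 1 / k := (abs_nonneg _).trans hcb
          have hcw : ‖c • (e (m + 1) - e m)‖ ≤ (1 - 1 / k) * (C * h ^ 2 * M ^ m) := by
            rw [norm_smul, Real.norm_eq_abs]
            gcongr
          have hcw' : ‖c • (e (m + 1) - e m)‖ ≤ C * h ^ 2 * M ^ m := by
            refine hcw.trans (mul_le_of_le_one_left (by positivity) ?_)
            have : 0 < 1 / k := by positivity
            linarith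
          have hMm : 1 ≤ M ^ m := one_le_pow₀ hM1
          have hcoef : L * (1 / K * M + h) ≤ K := by
            have h1 : 1 / K ≤ 1 := by rw [div_le_one hK0]; exact hK1
            have h2 : 1 / K * M = 1 / K + h := by rw [hM]; field_simp
            rw [h2]
            nlinarith
          calc ‖e (m + 2) - e (m + 1)‖
              = ‖(e (m + 2) - e (m + 1) - c • (e (m + 1) - e m)) + c • (e (m + 1) - e m)‖ := by
                rw [sub_add_cancel]
            _ ≤ (L * h ^ 2 * (C / K * h * M ^ (m + 1) + C * h ^ 2 * M ^ m)
                + C * (h ^ 2 / k)) + (1 - 1 / k) * (C * h ^ 2 * M ^ m) := by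
                refine (norm_add_le _ _).trans (add_le_add (hr.trans ?_) hcw)
                gcongr
                exact (norm_add_le _ _).trans (add_le_add hE hcw')
            _ = C * h ^ 2 * M ^ m + C * h ^ 3 * M ^ m * (L * (1 / K * M + h))
                - C * (h ^ 2 / k) * (M ^ m - 1) := by ring
            _ ≤ C * h ^ 2 * M ^ m + C * h ^ 3 * M ^ m * K := by
                have : 0 ≤ C * (h ^ 2 / k) * (M ^ m - 1) :=
                  mul_nonneg (by positivity) (by linarith)
                have : C * h ^ 3 * M ^ m * (L * (1 / K * M + h)) ≤ C * h ^ 3 * M ^ m * K := by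
                  gcongr
                linarith
            _ = C * h ^ 2 * M ^ (m + 1) := by rw [pow_succ, hM]; ring
      refine ⟨step, ?_⟩
      calc ‖e (m + 2)‖ = ‖e (m + 1) + (e (m + 2) - e (m + 1))‖ := by rw [add_sub_cancel]
        _ ≤ C / K * h * M ^ (m + 1) + C * h ^ 2 * M ^ (m + 1) :=
            (norm_add_le _ _).trans (add_le_add hE step)
        _ = C / K * h * M ^ (m + 2) := by
            rw [pow_succ _ (m + 1)]
            nth_rewrite 4 [hM]
            field_simp
  rcases n with _ | n
  · rw [he0, norm_zero]; positivity
  · exact (main n hn).2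

/-- **Convergence of Nesterov's scheme at rate `O(h·ln(1/h))`.**
Under the assumptions of the truncation theorem, for fixed `t > 0` and `n = t/h`, the
iterates `xₙ` of NAG started from `x₀ = x(0)`, `x₁ = x(h)` satisfy
`‖x(t) − x_{t/h}‖ ≤ C·h·ln(1/h)` for all sufficiently small `h > 0` with `t/h ∈ ℕ`. -/
theorem NAG_convergence_rate {d : ℕ}
    (F : EuclideanSpace ℝ (Fin d) → ℝ)
    (gradF : EuclideanSpace ℝ (Fin d) → EuclideanSpace ℝ (Fin d))
    (hgrad : ∀ u, HasGradientAt F (gradF u) u)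
    (L : NNReal) (hLip : LipschitzWith L gradF)
    (x : ℝ → EuclideanSpace ℝ (Fin d))
    (hx : ContDiff ℝ 3 x)
    (hode : ∀ t > (0:ℝ),
      deriv (deriv x) t + (3 / t) • deriv x t + gradF (x t) = 0)
    (t : ℝ) (ht : 0 < t) :
    ∃ C > (0:ℝ), ∃ δ > (0:ℝ), ∀ h : ℝ, 0 < h → h < δ → ∀ N : ℕ, t = (N : ℝ) * h →
      ∀ y : ℕ → EuclideanSpace ℝ (Fin d),
        y 0 = x 0 → y 1 = x h →
        (∀ n : ℕ, 1 ≤ n →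
          y (n + 1) = y n + (((n : ℝ) - 3) / (n : ℝ)) • (y n - y (n - 1))
            - h ^ 2 • gradF (y n + (((n : ℝ) - 3) / (n : ℝ)) • (y n - y (n - 1)))) →
        ‖x t - y N‖ ≤ C * h * Real.log (1 / h) := by
  have hx0 : ∀ s, HasDerivAt x (deriv x s) s := fun s =>
    (hx.differentiable (by norm_num) s).hasDerivAt
  have hx1 : ContDiff ℝ 2 (deriv x) := ContDiff.deriv' (hx.of_le (by norm_num))
  have hx2 : ContDiff ℝ 1 (deriv (deriv x)) := ContDiff.deriv' (hx1.of_le (by norm_num))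
  have hv : ∀ s, HasDerivAt (deriv x) (deriv (deriv x) s) s := fun s =>
    (hx1.differentiable (by norm_num) s).hasDerivAt
  have ha : ∀ s, HasDerivAt (deriv (deriv x)) (deriv (deriv (deriv x)) s) s := fun s =>
    (hx2.differentiable (by norm_num) s).hasDerivAt
  have hx3 : Continuous (deriv (deriv (deriv x))) := hx2.continuous_deriv le_rfl
  obtain ⟨B₁, hB₁⟩ := isCompact_Icc.exists_bound_of_continuousOn
    (s := Set.Icc 0 t) hx1.continuous.continuousOn
  obtain ⟨B₂, hB₂⟩ := isCompact_Icc.exists_bound_of_continuousOn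
    (s := Set.Icc 0 t) hx2.continuous.continuousOn
  obtain ⟨B₃, hB₃⟩ := isCompact_Icc.exists_bound_of_continuousOn
    (s := Set.Icc 0 t) hx3.continuousOn
  set C : ℝ := |3 / 2 * B₂ + 3 * B₃ * t + 2 * L * B₁ * t| + 1 with hC
  have hC0 : 0 < C := by positivity
  set K : ℝ := 4 * L + 1 with hK
  have hK0 : 0 < K := by positivity
  refine ⟨C / K * Real.exp (K * t), by positivity, Real.exp (-1), Real.exp_pos _, ?_⟩
  intro h hh hhδ N hN y hy0 hy1 hy
  have hlog : 1 ≤ Real.log (1 / h) := by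
    rw [one_div, Real.log_inv]
    have := Real.log_lt_log hh hhδ
    rw [Real.log_exp] at this
    linarith
  have hh1 : h ≤ 1 := hhδ.le.trans (Real.exp_le_one_iff.mpr (by norm_num))
  have hbound : ‖x (N * h) - y N‖ ≤ C / K * h * (1 + K * h) ^ N := by
    refine norm_le_of_nesterov_recursion (e := fun n : ℕ => x (n * h) - y n)
      L.coe_nonneg hC0.le hh hh1 (by simp [hy0]) (by simp [hy1]) ?_ le_rfl
    intro m hm c hc
    have hyr := hy (m + 1) (by omega)
    rw [← hc, Nat.add_sub_cancel] at hyr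
    set k : ℝ := ((m + 1 : ℕ) : ℝ) with hk
    have hk1 : 1 ≤ k := by rw [hk]; exact_mod_cast (by omega : 1 ≤ m + 1)
    have hkt : (k + 1) * h ≤ t := by
      rw [hN, hk]
      gcongr
      exact_mod_cast hm
    have hτ := norm_nesterov_truncation_le hLip hx0 hv ha hode hB₁ hB₂ hB₃ hh hk1 hkt hc
    have e1 : ((m + 2 : ℕ) : ℝ) = k + 1 := by rw [hk]; push_cast; ring
    have e2 : (m : ℝ) = k - 1 := by rw [hk]; push_cast; ring
    simp only [e1, e2]
    rw [hyr]
    set X := x (k * h) + c • (x (k * h) - x ((k - 1) * h)) with hX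
    set Y := y (m + 1) + c • (y (m + 1) - y m) with hY
    have hXY : x (k * h) - y (m + 1) + c • (x (k * h) - y (m + 1) - (x ((k - 1) * h) - y m))
        = X - Y := by rw [hX, hY]; module
    rw [hXY]
    calc _ = ‖(x ((k + 1) * h) - x (k * h) - c • (x (k * h) - x ((k - 1) * h)) + h ^ 2 • gradF X)
          - h ^ 2 • (gradF X - gradF Y)‖ := by
          congr 1
          generalize gradF X = g
          generalize gradF Y = g'
          rw [hY]
          module
      _ ≤ C * (h ^ 2 / k) + h ^ 2 * (L * ‖X - Y‖) := by
          refine (norm_sub_le _ _).trans (add_le_add (hτ.trans ?_) ?_)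
          · gcongr
            rw [hC]
            linarith [le_abs_self (3 / 2 * B₂ + 3 * B₃ * t + 2 * L * B₁ * t)]
          · rw [norm_smul, Real.norm_eq_abs, abs_of_nonneg (sq_nonneg h)]
            gcongr
            exact hLip.norm_sub_le _ _
      _ = _ := by ring
  rw [← hN] at hbound
  have hexp : (1 + K * h) ^ N ≤ Real.exp (K * t) := by
    have h1 : 1 + K * h ≤ Real.exp (K * h) := by linarith [Real.add_one_le_exp (K * h)]
    calc (1 + K * h) ^ N ≤ Real.exp (K * h) ^ N := by gcongr
      _ = Real.exp (K * t) := by rw [← Real.exp_nat_mul, hN]; congr 1; ring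
  calc ‖x t - y N‖ ≤ C / K * h * (1 + K * h) ^ N := hbound
    _ ≤ C / K * h * Real.exp (K * t) := by gcongr
    _ = C / K * Real.exp (K * t) * h * 1 := by ring
    _ ≤ C / K * Real.exp (K * t) * h * Real.log (1 / h) := by gcongr
end

section
/- Let F : ℝ^d → ℝ be such that ∇F is L-Lipschitz and has continuous, bounded first and second derivatives, and let x : ℝ → ℝ^d have a continuous fourth derivative and satisfy x''(t) + (3/t)·x'(t) + ∇F(x(t)) = 0 for t > 0. Fix t > 0. Then as h → 0, ∇F(x(t) + ((t−3h)/t)·(x(t)−x(t−h))) = −h·x'''(t) − (3h/t + 1)·x''(t) + (3h/t² − 3/t)·x'(t) + O(h²); i.e., the difference between the two sides is bounded in norm by a constant times h² for all sufficiently small h > 0. -/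
/-- A `C²` curve agrees with its first-order Taylor polynomial up to a quadratic error. -/
theorem ContDiff.exists_norm_sub_sub_smul_le {E : Type*} [NormedAddCommGroup E] [NormedSpace ℝ E]
    {f : ℝ → E} {f' : E} (hf : ContDiff ℝ 2 f) (hf' : HasDerivAt f f' 0) :
    ∃ C : ℝ, ∀ h ∈ Set.Icc (0 : ℝ) 1, ‖f h - f 0 - h • f'‖ ≤ C * h ^ 2 := by
  obtain ⟨C, hC⟩ := exists_taylor_mean_remainder_bound (f := f) (n := 1) (zero_le_one' ℝ)
    (by norm_num; exact hf.contDiffOn)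
  refine ⟨C, fun h hh => ?_⟩
  have key := hC h hh
  have hd : derivWithin f (Set.Icc 0 1) 0 = f' :=
    hf'.hasDerivWithinAt.derivWithin (uniqueDiffOn_Icc zero_lt_one 0 (by simp))
  rw [taylorWithinEval_succ, taylor_within_zero_eval, iteratedDerivWithin_one, hd] at key
  simpa [sub_sub] using key

/-- The extrapolated point `x(t) + ((t - 3h)/t)(x(t) - x(t - h))` has velocity `x'(t)` at `h = 0`. -/
theorem hasDerivAt_extrapolation {E : Type*} [NormedAddCommGroup E] [NormedSpace ℝ E]
    {x : ℝ → E} {x' : E} {t : ℝ} (hx : HasDerivAt x x' t) (ht : t ≠ 0) :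
    HasDerivAt (fun h : ℝ => x t + ((t - 3 * h) / t) • (x t - x (t - h))) x' 0 := by
  have dx : HasDerivAt x x' (t - 0) := by simpa using hx
  have dy := (dx.scomp (0 : ℝ) ((hasDerivAt_id (0 : ℝ)).const_sub t)).const_sub (x t)
  have dc := (((hasDerivAt_id (0 : ℝ)).const_mul 3).const_sub t).div_const t
  refine ((dc.smul dy).const_add (x t)).congr_deriv ?_
  simp [ht]

/-- Differentiating the equation `x'' + (3/t) x' + G(x) = 0` along the trajectory. -/
theorem fderiv_apply_deriv_of_ode {E : Type*} [NormedAddCommGroup E] [NormedSpace ℝ E]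
    {G : E → E} {x : ℝ → E} (hG : Differentiable ℝ G) (hx : ContDiff ℝ 3 x)
    (hode : ∀ t > (0 : ℝ), deriv (deriv x) t + (3 / t) • deriv x t + G (x t) = 0)
    {t : ℝ} (ht : 0 < t) :
    fderiv ℝ G (x t) (deriv x t) =
      -deriv (deriv (deriv x)) t - (3 / t) • deriv (deriv x) t + (3 / t ^ 2) • deriv x t := by
  have hx1 : ContDiff ℝ 2 (deriv x) := ((contDiff_succ_iff_deriv (n := 2)).1 hx).2.2
  have hx2 : ContDiff ℝ 1 (deriv (deriv x)) := ((contDiff_succ_iff_deriv (n := 1)).1 hx1).2.2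
  have d0 := (hx.differentiable (by norm_num) t).hasDerivAt
  have d1 := (hx1.differentiable (by norm_num) t).hasDerivAt
  have d2 := (hx2.differentiable (by norm_num) t).hasDerivAt
  have dc : HasDerivAt (fun s : ℝ => 3 / s) (-(3 / t ^ 2)) t := by
    simpa [div_eq_mul_inv] using (hasDerivAt_inv ht.ne').const_mul (3 : ℝ)
  have dsum := (d2.add (dc.smul d1)).add ((hG (x t)).hasFDerivAt.comp_hasDerivAt t d0)
  have dzero : HasDerivAt (fun _ : ℝ => (0 : E)) 0 t := hasDerivAt_const t 0
  have huniq := dsum.unique (dzero.congr_of_eventuallyEq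
    (Filter.mem_of_superset (Ioi_mem_nhds ht) fun s hs => hode s hs))
  rw [add_comm] at huniq
  rw [eq_neg_of_add_eq_zero_left huniq]
  module


/-- **Second-order expansion of the gradient term.**
If `∇F` is `L`-Lipschitz and twice continuously differentiable with bounded first and
second derivatives, and `x` has a continuous fourth derivative and solves
`x''(t) + (3/t)x'(t) + ∇F(x(t)) = 0` for `t > 0`, then for fixed `t > 0`,
`∇F(x(t) + ((t−3h)/t)(x(t)−x(t−h)))
  = −h·x'''(t) − (3h/t + 1)·x''(t) + (3h/t² − 3/t)·x'(t) + O(h²)` as `h → 0`. -/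
theorem gradient_term_second_order {d : ℕ}
    (F : EuclideanSpace ℝ (Fin d) → ℝ)
    (gradF : EuclideanSpace ℝ (Fin d) → EuclideanSpace ℝ (Fin d))
    (hgrad : ∀ u, HasGradientAt F (gradF u) u)
    (L : NNReal) (hLip : LipschitzWith L gradF)
    (hgrad2 : ContDiff ℝ 2 gradF)
    (B : ℝ)
    (hbdd : ∀ u, ‖fderiv ℝ gradF u‖ ≤ B ∧ ‖fderiv ℝ (fderiv ℝ gradF) u‖ ≤ B)
    (x : ℝ → EuclideanSpace ℝ (Fin d))
    (hx : ContDiff ℝ 4 x)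
    (hode : ∀ t > (0:ℝ),
      deriv (deriv x) t + (3 / t) • deriv x t + gradF (x t) = 0)
    (t : ℝ) (ht : 0 < t) :
    ∃ C > (0:ℝ), ∃ δ > (0:ℝ), ∀ h : ℝ, 0 < h → h < δ →
      ‖gradF (x t + ((t - 3 * h) / t) • (x t - x (t - h)))
          - (-(h • deriv (deriv (deriv x)) t) - (3 * h / t + 1) • deriv (deriv x) t
              + (3 * h / t ^ 2 - 3 / t) • deriv x t)‖ ≤ C * h ^ 2 := by
  have hx2 : ContDiff ℝ 2 x := hx.of_le (by norm_num)
  have hG : Differentiable ℝ gradF := hgrad2.differentiable (by norm_num)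
  have hp : ContDiff ℝ 2 fun h : ℝ => x t + ((t - 3 * h) / t) • (x t - x (t - h)) := by
    fun_prop
  have hp' : HasDerivAt (fun h : ℝ => x t + ((t - 3 * h) / t) • (x t - x (t - h)))
      (deriv x t) 0 :=
    hasDerivAt_extrapolation (hx2.differentiable (by norm_num) t).hasDerivAt ht.ne'
  have hg' : HasDerivAt (fun h : ℝ => gradF (x t + ((t - 3 * h) / t) • (x t - x (t - h))))
      (fderiv ℝ gradF (x t) (deriv x t)) 0 := by
    refine HasFDerivAt.comp_hasDerivAt (0 : ℝ) ?_ hp'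
    simpa using (hG (x t)).hasFDerivAt
  obtain ⟨C, hC⟩ := (hgrad2.comp hp).exists_norm_sub_sub_smul_le hg'
  refine ⟨max C 1, by positivity, 1, one_pos, fun h h0 h1 => ?_⟩
  refine le_trans (le_of_eq_of_le (congrArg norm ?_) (hC h ⟨h0.le, h1.le⟩)) (by gcongr; simp)
  have hval : gradF (x t) = -(deriv (deriv x) t + (3 / t) • deriv x t) :=
    eq_neg_of_add_eq_zero_right (hode t ht)
  rw [fderiv_apply_deriv_of_ode hG (hx.of_le (by norm_num)) hode ht]
  simp only [Function.comp_apply, sub_zero, sub_self, smul_zero, add_zero, hval]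
  module
end

section
/- Let F : ℝ^d → ℝ be such that ∇F is L-Lipschitz and has continuous, bounded first and second derivatives, and let x : ℝ → ℝ^d have a continuous fourth derivative and satisfy x''(t) + (3/t)·x'(t) + ∇F(x(t)) = 0 for t > 0. Fix t > 0. Define the SAG truncation error L[x(t);h] = (2 + 4h/t)·x(t+h) + (−5 − (9/2)·h/t − 3h²/t²)·x(t) + (4 + 3h²/t²)·x(t−h) + (−1 + (1/2)·h/t)·x(t−2h) + h²·∇F(x(t) + ((t−3h)/t)·(x(t)−x(t−h))). Then L[x(t);h] = O(h⁴) as h → 0. -/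
open Asymptotics Filter Topology in
/-- Taylor's theorem in big-O form, with increments at the base point. -/
theorem taylor_isBigO_add {E : Type*} [NormedAddCommGroup E] [NormedSpace ℝ E]
    {f : ℝ → E} {n : ℕ} (hf : ContDiff ℝ (n + 1 : ℕ) f) (a : ℝ) :
    (fun h : ℝ ↦ f (a + h) -
        ∑ k ∈ Finset.range (n + 1), ((k.factorial : ℝ)⁻¹ * h ^ k) • iteratedDeriv k f a)
      =O[𝓝 0] fun h ↦ h ^ (n + 1) := by
  have hshift : Tendsto (fun h : ℝ ↦ a + h) (𝓝 0) (𝓝 a) := by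
    have : Continuous fun h : ℝ ↦ a + h := by fun_prop
    simpa using this.tendsto 0
  have hrem := ((taylor_isLittleO_univ (x₀ := a) hf).comp_tendsto hshift).isBigO
  have hlast : (fun h : ℝ ↦ (((n + 1).factorial : ℝ)⁻¹ * h ^ (n + 1)) • iteratedDeriv (n + 1) f a)
      =O[𝓝 0] fun h ↦ h ^ (n + 1) := by
    refine IsBigO.of_bound (‖((n + 1).factorial : ℝ)⁻¹‖ * ‖iteratedDeriv (n + 1) f a‖)
      (Eventually.of_forall fun h ↦ le_of_eq ?_)
    rw [norm_smul, norm_mul]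
    ring
  simp only [Function.comp_def, taylor_within_apply, iteratedDerivWithin_univ,
    add_sub_cancel_left] at hrem
  refine (hrem.add hlast).congr_left fun h ↦ ?_
  rw [Finset.sum_range_succ _ (n + 1)]
  abel

/-- Differentiating `x'' + (3/t) x' + G(x) = 0` in time. -/
theorem deriv_damped_ode {E : Type*} [NormedAddCommGroup E] [NormedSpace ℝ E]
    {G : E → E} (hG : Differentiable ℝ G) {x : ℝ → E} (hx : ContDiff ℝ 3 x)
    (hode : ∀ t > (0 : ℝ), deriv (deriv x) t + (3 / t) • deriv x t + G (x t) = 0)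
    {t : ℝ} (ht : 0 < t) :
    iteratedDeriv 3 x t + (3 / t) • iteratedDeriv 2 x t - (3 / t ^ 2) • deriv x t
      + fderiv ℝ G (x t) (deriv x t) = 0 := by
  have hx0 : HasDerivAt x (deriv x t) t := (hx.differentiable (by norm_num) t).hasDerivAt
  have hx1 : HasDerivAt (deriv x) (iteratedDeriv 2 x t) t := by
    have := (hx.differentiable_iteratedDeriv 1 (by norm_num) t).hasDerivAt
    rwa [← iteratedDeriv_succ, iteratedDeriv_one] at this
  have hx2 : HasDerivAt (deriv (deriv x)) (iteratedDeriv 3 x t) t := by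
    have := (hx.differentiable_iteratedDeriv 2 (by norm_num) t).hasDerivAt
    rwa [← iteratedDeriv_succ, iteratedDeriv_succ (n := 1), iteratedDeriv_one] at this
  have hcoef : HasDerivAt (fun s : ℝ ↦ 3 / s) (-(3 / t ^ 2)) t := by
    simpa [div_eq_mul_inv] using (hasDerivAt_inv ht.ne').const_mul (3 : ℝ)
  have hsum := (hx2.add (hcoef.smul hx1)).add ((hG (x t)).hasFDerivAt.comp_hasDerivAt t hx0)
  have hzero : HasDerivAt (fun _ : ℝ ↦ (0 : E)) _ t := hsum.congr_of_eventuallyEq <| by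
    filter_upwards [lt_mem_nhds ht] with s hs using (hode s hs).symm
  rw [← hzero.unique (hasDerivAt_const t 0)]
  module

open Asymptotics Filter Topology in
/-- First-order expansion of a `C²` map at the SAG extrapolation point. -/
theorem extrapolated_comp_isBigO {E : Type*} [NormedAddCommGroup E] [NormedSpace ℝ E]
    {G : E → E} (hG : ContDiff ℝ 2 G) {x : ℝ → E} (hx : ContDiff ℝ 2 x) {t : ℝ} (ht : t ≠ 0) :
    (fun h : ℝ ↦ G (x t + ((t - 3 * h) / t) • (x t - x (t - h)))
        - (G (x t) + h • fderiv ℝ G (x t) (deriv x t)))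
      =O[𝓝 0] fun h ↦ h ^ 2 := by
  set u : ℝ → E := fun h ↦ x t + ((t - 3 * h) / t) • (x t - x (t - h)) with hu
  have hu_smooth : ContDiff ℝ 2 u := by fun_prop
  have hu0 : u 0 = x t := by simp [hu]
  have hu_deriv : HasDerivAt u (deriv x t) 0 := by
    have hxt : HasDerivAt x (deriv x t) (t - 0) := by
      rw [sub_zero]
      exact (hx.differentiable (by norm_num) t).hasDerivAt
    have hback : HasDerivAt (fun h : ℝ ↦ x (t - h)) (-deriv x t) 0 := by
      simpa [Function.comp_def] using hxt.scomp (0 : ℝ) ((hasDerivAt_id (0 : ℝ)).const_sub t)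
    have hcoef : HasDerivAt (fun h : ℝ ↦ (t - 3 * h) / t) (-(3 * 1) / t) 0 :=
      (((hasDerivAt_id (0 : ℝ)).const_mul 3).const_sub t).div_const t
    have := (hcoef.smul (hback.const_sub (x t))).const_add (x t)
    simpa [ht, hu] using this
  have hGu : HasDerivAt (fun h ↦ G (u h)) (fderiv ℝ G (x t) (deriv x t)) 0 := by
    have hGx : HasFDerivAt G (fderiv ℝ G (x t)) (u 0) := by
      rw [hu0]
      exact (hG.differentiable (by norm_num) (x t)).hasFDerivAt
    exact hGx.comp_hasDerivAt 0 hu_deriv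
  have hGu_smooth : ContDiff ℝ ((1 + 1 : ℕ)) (fun h ↦ G (u h)) := by
    exact_mod_cast hG.comp hu_smooth
  simpa [Finset.sum_range_succ, iteratedDeriv_one, hGu.deriv, hu0] using
    taylor_isBigO_add hGu_smooth 0


/-- **Truncation error of the SAG scheme is `O(h⁴)`.**
Under the regularity assumptions (∇F `L`-Lipschitz, twice continuously differentiable with
bounded first and second derivatives; `x` with continuous fourth derivative solving
`x''(t) + (3/t)x'(t) + ∇F(x(t)) = 0` for `t > 0`), for fixed `t > 0` the SAG truncation
error with coefficients `α = (2,−5,4,−1)`, `β = (4,−9/2,0,1/2)`, `γ = (0,−3,3,0)` is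
`O(h⁴)` as `h → 0`. -/
theorem SAG_truncation_error_O_h4 {d : ℕ}
    (F : EuclideanSpace ℝ (Fin d) → ℝ)
    (gradF : EuclideanSpace ℝ (Fin d) → EuclideanSpace ℝ (Fin d))
    (hgrad : ∀ u, HasGradientAt F (gradF u) u)
    (L : NNReal) (hLip : LipschitzWith L gradF)
    (hgrad2 : ContDiff ℝ 2 gradF)
    (B : ℝ)
    (hbdd : ∀ u, ‖fderiv ℝ gradF u‖ ≤ B ∧ ‖fderiv ℝ (fderiv ℝ gradF) u‖ ≤ B)
    (x : ℝ → EuclideanSpace ℝ (Fin d))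
    (hx : ContDiff ℝ 4 x)
    (hode : ∀ t > (0:ℝ),
      deriv (deriv x) t + (3 / t) • deriv x t + gradF (x t) = 0)
    (t : ℝ) (ht : 0 < t) :
    ∃ M > (0:ℝ), ∃ δ > (0:ℝ), ∀ h : ℝ, 0 < h → h < δ →
      ‖(2 + 4 * h / t) • x (t + h)
          + (-5 - (9 / 2) * h / t - 3 * h ^ 2 / t ^ 2) • x t
          + (4 + 3 * h ^ 2 / t ^ 2) • x (t - h)
          + (-1 + (1 / 2) * h / t) • x (t - 2 * h)
          + h ^ 2 • gradF (x t + ((t - 3 * h) / t) • (x t - x (t - h)))‖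
        ≤ M * h ^ 4 := by
  open Asymptotics Filter Topology in
  suffices hO : (fun h : ℝ ↦ (2 + 4 * h / t) • x (t + h)
          + (-5 - (9 / 2) * h / t - 3 * h ^ 2 / t ^ 2) • x t
          + (4 + 3 * h ^ 2 / t ^ 2) • x (t - h)
          + (-1 + (1 / 2) * h / t) • x (t - 2 * h)
          + h ^ 2 • gradF (x t + ((t - 3 * h) / t) • (x t - x (t - h))))
        =O[𝓝 0] fun h ↦ h ^ 4 by
    obtain ⟨M, hM, hbound⟩ := hO.exists_pos
    obtain ⟨δ, hδ, hball⟩ := Metric.eventually_nhds_iff.1 hbound.bound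
    refine ⟨M, hM, δ, hδ, fun h hpos hlt ↦ ?_⟩
    have := hball (y := h) (by simpa [abs_of_pos hpos] using hlt)
    rwa [Real.norm_of_nonneg (by positivity : (0 : ℝ) ≤ h ^ 4)] at this
  have hsecond : deriv (deriv x) t = iteratedDeriv 2 x t := by
    rw [iteratedDeriv_succ, iteratedDeriv_one]
  have hode0 := hode t ht
  rw [hsecond] at hode0
  have hode1 := deriv_damped_ode (hgrad2.differentiable (by norm_num))
    (hx.of_le (by norm_num)) hode ht
  have hG := extrapolated_comp_isBigO hgrad2 (hx.of_le (by norm_num)) ht.ne'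
  have hT := taylor_isBigO_add (n := 3) (by exact_mod_cast hx) t
  simp only [Finset.sum_range_succ, Finset.sum_range_zero, iteratedDeriv_zero, iteratedDeriv_one,
    Nat.factorial] at hT
  set G₀ := gradF (x t)
  set G₁ := fderiv ℝ gradF (x t) (deriv x t)
  set x₁ := deriv x t
  set x₂ := iteratedDeriv 2 x t
  set x₃ := iteratedDeriv 3 x t
  set r : ℝ → EuclideanSpace ℝ (Fin d) := fun h ↦
    x (t + h) - (x t + h • x₁ + (h ^ 2 / 2) • x₂ + (h ^ 3 / 6) • x₃) with hr
  have hr4 : r =O[𝓝 0] fun h : ℝ ↦ h ^ 4 := by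
    refine hT.congr_left fun h ↦ ?_
    simp only [hr]
    push_cast
    module
  have hr_scaled (c : ℝ) : (fun h ↦ r (c * h)) =O[𝓝 0] fun h : ℝ ↦ h ^ 4 := by
    have hc : Tendsto (fun h : ℝ ↦ c * h) (𝓝 0) (𝓝 0) := by
      simpa using (continuous_const_mul c).tendsto 0
    refine (hr4.comp_tendsto hc).trans ?_
    simpa [Function.comp_def, mul_pow] using
      (isBigO_refl (fun h : ℝ ↦ h ^ 4) (𝓝 0)).const_mul_left (c ^ 4)
  have hsmul {a : ℝ → ℝ} (ha : Continuous a) {v : ℝ → EuclideanSpace ℝ (Fin d)}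
      (hv : v =O[𝓝 0] fun h : ℝ ↦ h ^ 4) : (fun h ↦ a h • v h) =O[𝓝 0] fun h : ℝ ↦ h ^ 4 := by
    simpa using ((ha.tendsto 0).isBigO_one ℝ).smul hv
  have hh4 : (fun h : ℝ ↦ h ^ 4 • ((3 / (2 * t ^ 2)) • x₂ - (h / (2 * t ^ 2)) • x₃))
      =O[𝓝 0] fun h : ℝ ↦ h ^ 4 := by
    have hcont : Continuous fun h : ℝ ↦ (3 / (2 * t ^ 2)) • x₂ - (h / (2 * t ^ 2)) • x₃ := by
      fun_prop
    simpa using (isBigO_refl (fun h : ℝ ↦ h ^ 4) (𝓝 0)).smul ((hcont.tendsto 0).isBigO_one ℝ)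
  have hGrem := (isBigO_refl (fun h : ℝ ↦ h ^ 2) (𝓝 0)).smul hG
  simp only [smul_eq_mul, ← pow_add] at hGrem
  refine ((((hsmul (a := fun h ↦ 2 + 4 * h / t) (by fun_prop) hr4).add
    (hsmul (a := fun h ↦ 4 + 3 * h ^ 2 / t ^ 2) (by fun_prop) (hr_scaled (-1)))).add
    (hsmul (a := fun h ↦ -1 + (1 / 2) * h / t) (by fun_prop) (hr_scaled (-2)))).add
    (hGrem.add hh4)).congr_left fun h ↦ ?_
  simp only [hr, show t + -1 * h = t - h by ring, show t + -2 * h = t - 2 * h by ring]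
  linear_combination (norm := module) (-h ^ 2) • hode0 - (h ^ 3) • hode1
end

section
/- Let F : ℝ^d → ℝ be such that ∇F is L-Lipschitz and has continuous, bounded first and second derivatives, and let x : ℝ → ℝ^d have a continuous fourth derivative and satisfy x''(t) + (3/t)·x'(t) + ∇F(x(t)) = 0 for t > 0. Fix t > 0 and arbitrary real parameters k, m₁, m₂. Set α₁ = 2, α₂ = −5, α₃ = 4, α₄ = −1; β₁ = 9/2 − k, β₂ = −6 + 3k, β₃ = 3/2 − 3k, β₄ = k; γ₁ = m₁, γ₂ = −(3m₁ + m₂ + 3)/2, γ₃ = m₂, γ₄ = (m₁ − m₂ + 3)/2. Then the truncation error L[x(t);h] = Σ_{i=1}^{4} (α_i + β_i·h/t + γ_i·h²/t²)·x(t + (2−i)·h) + h²·∇F(x(t) + ((t−3h)/t)·(x(t)−x(t−h))) satisfies L[x(t);h] = O(h⁴) as h → 0. -/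
open Filter Topology Asymptotics

/-- Taylor's theorem with a big-O remainder, for functions of a real variable. -/
theorem isBigO_sub_taylor {E : Type*} [NormedAddCommGroup E] [NormedSpace ℝ E] {f : ℝ → E}
    {n : ℕ} (hf : ContDiff ℝ (n + 1 : ℕ) f) (a : ℝ) :
    (fun s => f (a + s) -
        ∑ i ∈ Finset.range (n + 1), ((i.factorial : ℝ)⁻¹ * s ^ i) • iteratedDeriv i f a)
      =O[𝓝 0] fun s => s ^ (n + 1) := by
  have htend : Tendsto (fun s : ℝ => a + s) (𝓝 0) (𝓝 a) := by
    simpa using (continuous_const_add a).tendsto 0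
  have h := (taylor_isLittleO_univ (x₀ := a) hf).isBigO.comp_tendsto htend
  simp only [Function.comp_def, taylor_within_apply, add_sub_cancel_left,
    iteratedDerivWithin_univ, Finset.sum_range_succ _ (n + 1)] at h
  have hlast : (fun s : ℝ => (((n + 1).factorial : ℝ)⁻¹ * s ^ (n + 1)) •
      iteratedDeriv (n + 1) f a) =O[𝓝 0] fun s => s ^ (n + 1) := by
    refine IsBigO.of_bound (‖((n + 1).factorial : ℝ)⁻¹‖ * ‖iteratedDeriv (n + 1) f a‖)
      (Eventually.of_forall fun s => ?_)
    rw [norm_smul, norm_mul]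
    exact le_of_eq (by ring)
  exact (h.add hlast).congr_left fun s => by abel

/-- **Truncation error of the general four-point scheme is `O(h⁴)`.**
For arbitrary parameters `k, m₁, m₂`, with coefficients
`α = (2,−5,4,−1)`, `β = (9/2−k, −6+3k, 3/2−3k, k)`,
`γ = (m₁, −(3m₁+m₂+3)/2, m₂, (m₁−m₂+3)/2)`, the truncation error
`Σᵢ (αᵢ + βᵢh/t + γᵢh²/t²)·x(t+(2−i)h) + h²∇F(x(t) + ((t−3h)/t)(x(t)−x(t−h)))`
is `O(h⁴)` as `h → 0`. -/
theorem four_point_truncation_error_O_h4 {d : ℕ}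
    (F : EuclideanSpace ℝ (Fin d) → ℝ)
    (gradF : EuclideanSpace ℝ (Fin d) → EuclideanSpace ℝ (Fin d))
    (hgrad : ∀ u, HasGradientAt F (gradF u) u)
    (L : NNReal) (hLip : LipschitzWith L gradF)
    (hgrad2 : ContDiff ℝ 2 gradF)
    (B : ℝ)
    (hbdd : ∀ u, ‖fderiv ℝ gradF u‖ ≤ B ∧ ‖fderiv ℝ (fderiv ℝ gradF) u‖ ≤ B)
    (x : ℝ → EuclideanSpace ℝ (Fin d))
    (hx : ContDiff ℝ 4 x)
    (hode : ∀ t > (0:ℝ),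
      deriv (deriv x) t + (3 / t) • deriv x t + gradF (x t) = 0)
    (t : ℝ) (ht : 0 < t) (k m₁ m₂ : ℝ) :
    ∃ M > (0:ℝ), ∃ δ > (0:ℝ), ∀ h : ℝ, 0 < h → h < δ →
      ‖(2 + (9 / 2 - k) * h / t + m₁ * h ^ 2 / t ^ 2) • x (t + h)
          + (-5 + (-6 + 3 * k) * h / t + (-(3 * m₁ + m₂ + 3) / 2) * h ^ 2 / t ^ 2) • x t
          + (4 + (3 / 2 - 3 * k) * h / t + m₂ * h ^ 2 / t ^ 2) • x (t - h)
          + (-1 + k * h / t + ((m₁ - m₂ + 3) / 2) * h ^ 2 / t ^ 2) • x (t - 2 * h)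
          + h ^ 2 • gradF (x t + ((t - 3 * h) / t) • (x t - x (t - h)))‖
        ≤ M * h ^ 4 := by
  have hx1 : ContDiff ℝ 3 (deriv x) := ((contDiff_succ_iff_deriv (n := 3)).1 hx).2.2
  have hx2 : ContDiff ℝ 2 (deriv (deriv x)) := ((contDiff_succ_iff_deriv (n := 2)).1 hx1).2.2
  have hdx : HasDerivAt x (deriv x t) t := (hx.differentiable (by norm_num) t).hasDerivAt
  have hdx1 : HasDerivAt (deriv x) (deriv (deriv x) t) t :=
    (hx1.differentiable (by norm_num) t).hasDerivAt
  have hdx2 : HasDerivAt (deriv (deriv x)) (deriv (deriv (deriv x)) t) t :=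
    (hx2.differentiable (by norm_num) t).hasDerivAt
  have hdgrad (u : EuclideanSpace ℝ (Fin d)) : HasFDerivAt gradF (fderiv ℝ gradF u) u :=
    (hgrad2.differentiable (by norm_num) u).hasFDerivAt
  -- Differentiating the ODE expresses the third derivative of `x`.
  have hode' : deriv (deriv (deriv x)) t + (3 / t) • deriv (deriv x) t
      - (3 / t ^ 2) • deriv x t + fderiv ℝ gradF (x t) (deriv x t) = 0 := by
    have hdiv : HasDerivAt (fun s : ℝ => 3 / s) (-(3 / t ^ 2)) t := by
      simpa [div_eq_mul_inv] using (hasDerivAt_inv ht.ne').const_mul 3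
    have hder := (hdx2.add (hdiv.smul hdx1)).add ((hdgrad (x t)).comp_hasDerivAt t hdx)
    have hzero : HasDerivAt (fun _ : ℝ => (0 : EuclideanSpace ℝ (Fin d))) 0 t :=
      hasDerivAt_const t 0
    have heq := hder.unique (hzero.congr_of_eventuallyEq
      ((lt_mem_nhds ht).mono fun s hs => hode s hs))
    rw [← heq]
    module
  set r : ℝ → EuclideanSpace ℝ (Fin d) := fun s => x (t + s) -
    (x t + s • deriv x t + (s ^ 2 / 2) • deriv (deriv x) t
      + (s ^ 3 / 6) • deriv (deriv (deriv x)) t) with hr_def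
  have hr : r =O[𝓝 0] fun s => s ^ 4 := by
    refine (isBigO_sub_taylor (n := 3) hx t).congr_left fun s => ?_
    simp only [Finset.sum_range_succ, Finset.sum_range_zero, iteratedDeriv_succ,
      iteratedDeriv_zero, Nat.factorial, hr_def]
    push_cast
    module
  have hr_mul (c : ℝ) : (fun h => r (c * h)) =O[𝓝 0] fun h => h ^ 4 := by
    have htend : Tendsto (fun h : ℝ => c * h) (𝓝 0) (𝓝 0) := by
      simpa using (continuous_const_mul c).tendsto 0
    refine (hr.comp_tendsto htend).trans ?_
    simp only [Function.comp_def, mul_pow]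
    exact isBigO_const_mul_self _ _ _
  set y : ℝ → EuclideanSpace ℝ (Fin d) :=
    fun h => x t + ((t - 3 * h) / t) • (x t - x (t - h)) with hy_def
  have hy : ContDiff ℝ 2 y := by
    have hx' : ContDiff ℝ 2 x := hx.of_le (by norm_num)
    fun_prop
  have hy0 : y 0 = x t := by simp [hy_def]
  have hdy : HasDerivAt y (deriv x t) 0 := by
    have hback : HasDerivAt (fun h : ℝ => x (t - h)) (-deriv x t) 0 := by
      exact HasDerivAt.comp_const_sub t 0 (by simpa using hdx)
    have hcoef : HasDerivAt (fun h : ℝ => (t - 3 * h) / t) (-3 / t) 0 := by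
      simpa using (((hasDerivAt_id (0 : ℝ)).const_mul 3).const_sub t).div_const t
    have := (hcoef.smul (hback.const_sub (x t))).const_add (x t)
    exact this.congr_deriv (by simp [ht.ne'])
  set g : ℝ → EuclideanSpace ℝ (Fin d) := fun h =>
    gradF (y h) - (gradF (x t) + h • fderiv ℝ gradF (x t) (deriv x t)) with hg_def
  have hg : g =O[𝓝 0] fun h => h ^ 2 := by
    have hderiv : deriv (fun h => gradF (y h)) 0 = fderiv ℝ gradF (x t) (deriv x t) := by
      have := (hdgrad (y 0)).comp_hasDerivAt 0 hdy
      rw [hy0] at this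
      exact this.deriv
    refine (isBigO_sub_taylor (n := 1) (hgrad2.comp hy) 0).congr_left fun s => ?_
    simp only [Finset.sum_range_succ, Finset.sum_range_zero, iteratedDeriv_succ,
      iteratedDeriv_zero, Nat.factorial, hg_def, Function.comp_def, hderiv, hy0, zero_add]
    push_cast
    module
  set p : ℝ → EuclideanSpace ℝ (Fin d) := fun h =>
    ((3 * m₁ - m₂ + 6) / (2 * t ^ 2)) • deriv (deriv x) t
      + ((1 - 2 * k) / (2 * t) + h * (m₂ - m₁ - 4) / (2 * t ^ 2)) •
        deriv (deriv (deriv x)) t with hp_def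
  have hbounded {E : Type} [NormedAddCommGroup E] {c : ℝ → E} (hc : Continuous c) :
      c =O[𝓝 0] fun _ => (1 : ℝ) := hc.continuousAt.norm.isBoundedUnder_le.isBigO_one ℝ
  have hsmul {c : ℝ → ℝ} (hc : Continuous c) {v : ℝ → EuclideanSpace ℝ (Fin d)}
      (hv : v =O[𝓝 0] fun h => h ^ 4) : (fun h => c h • v h) =O[𝓝 0] fun h => h ^ 4 := by
    simpa using (hbounded hc).smul hv
  have hp : (fun h : ℝ => h ^ 4 • p h) =O[𝓝 0] fun h => h ^ 4 := by
    simpa using (isBigO_refl (fun h : ℝ => h ^ 4) (𝓝 0)).smul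
      (hbounded (c := p) (by fun_prop))
  have hg' : (fun h : ℝ => h ^ 2 • g h) =O[𝓝 0] fun h => h ^ 4 :=
    ((isBigO_refl (fun h : ℝ => h ^ 2) (𝓝 0)).smul hg).congr_right fun h => by
      simp only [smul_eq_mul]; ring
  have hsum := ((((hsmul (c := fun h => 2 + (9 / 2 - k) * h / t + m₁ * h ^ 2 / t ^ 2)
      (by fun_prop) (hr_mul 1)).add
    (hsmul (c := fun h => 4 + (3 / 2 - 3 * k) * h / t + m₂ * h ^ 2 / t ^ 2)
      (by fun_prop) (hr_mul (-1)))).add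
    (hsmul (c := fun h => -1 + k * h / t + ((m₁ - m₂ + 3) / 2) * h ^ 2 / t ^ 2)
      (by fun_prop) (hr_mul (-2)))).add hg').add hp
  obtain ⟨M, hM, hbound⟩ := hsum.exists_pos
  obtain ⟨δ, hδ, hball⟩ := Metric.eventually_nhds_iff.1 hbound.bound
  refine ⟨M, hM, δ, hδ, fun h hh hhδ => ?_⟩
  have hle := hball (y := h) (by simpa [abs_of_pos hh] using hhδ)
  rw [Real.norm_of_nonneg (by positivity : (0 : ℝ) ≤ h ^ 4)] at hle
  refine le_of_eq_of_le (congrArg norm ?_) hle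
  have hgrad_eq : gradF (x t) = -deriv (deriv x) t - (3 / t) • deriv x t := by
    rw [← sub_eq_zero, ← hode t ht]; module
  have hhess_eq : fderiv ℝ gradF (x t) (deriv x t) = -deriv (deriv (deriv x)) t
      - (3 / t) • deriv (deriv x) t + (3 / t ^ 2) • deriv x t := by
    rw [← sub_eq_zero, ← hode']; module
  simp only [hr_def, hg_def, hp_def, hgrad_eq, hhess_eq, one_mul, neg_mul, ← sub_eq_add_neg]
  match_scalars <;> field_simp <;> ring
end
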